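/- Impossibility of balanced saturation on odd cycles: Let h ≥ 5 be odd and consider 2h qubits labeled 1,…,2h with label 2h+1 identified with 1. For a 2h-qubit density matrix ρ define, for j = 1,…,h, 𝒳_j(ρ) = (Tr(ρ σ_x^{(2j−1)} σ_x^{(2j)} σ_y^{(2j+1)}))² + (Tr(ρ σ_x^{(2j−1)} σ_y^{(2j)} σ_y^{(2j+1)}))². Then there is no 2h-qubit density matrix ρ with 𝒳_j(ρ) = 1/2 for every j = 1,…,h. -/

import Mathlib

open Matrix Complex ComplexOrder

noncomputable section

/-- The Pauli X matrix. -/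
def pX : Matrix (Fin 2) (Fin 2) ℂ := !![0, 1; 1, 0]

/-- The Pauli Y matrix. -/
def pY : Matrix (Fin 2) (Fin 2) ℂ := !![0, -Complex.I; Complex.I, 0]

/-- The Pauli Z matrix. -/
def pZ : Matrix (Fin 2) (Fin 2) ℂ := !![1, 0; 0, -1]

/-- The operator on `n` qubits acting as the single-qubit operator `M` on qubit `i`
and as the identity on all other qubits. -/
def onQubit {n : ℕ} (M : Matrix (Fin 2) (Fin 2) ℂ) (i : Fin n) :
    Matrix (Fin n → Fin 2) (Fin n → Fin 2) ℂ :=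
  Matrix.of fun a b => ∏ s, if s = i then M (a s) (b s) else (if a s = b s then 1 else 0)

/-- An `n`-qubit density matrix: positive semidefinite with unit trace. -/
def IsDensityMatrix {n : ℕ} (ρ : Matrix (Fin n → Fin 2) (Fin n → Fin 2) ℂ) : Prop :=
  ρ.PosSemidef ∧ ρ.trace = 1

/-- The two Pauli matrices spanning the xy plane. -/
def XY : Fin 2 → Matrix (Fin 2) (Fin 2) ℂ := ![pX, pY]

/-- The two Pauli matrices spanning the xz plane. -/
def XZ : Fin 2 → Matrix (Fin 2) (Fin 2) ℂ := ![pX, pZ]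

/-- The xy-plane Bell strength 𝒯²_{ij}(ρ) of the pair of qubits (i,j). -/
def T2pair {n : ℕ} (ρ : Matrix (Fin n → Fin 2) (Fin n → Fin 2) ℂ) (i j : Fin n) : ℝ :=
  ∑ k : Fin 2, ∑ l : Fin 2,
    ((ρ * (onQubit (XY k) i * onQubit (XY l) j)).trace.re) ^ 2

/-- The xy-plane Bell strength 𝒯²_{ijm}(ρ) of the triple of qubits (i,j,m). -/
def T2triple {n : ℕ} (ρ : Matrix (Fin n → Fin 2) (Fin n → Fin 2) ℂ) (i j m : Fin n) : ℝ :=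
  ∑ k : Fin 2, ∑ l : Fin 2, ∑ p : Fin 2,
    ((ρ * (onQubit (XY k) i * onQubit (XY l) j * onQubit (XY p) m)).trace.re) ^ 2

/-- The xy-plane Bell strength 𝒯²_{ijml}(ρ) of the quadruple of qubits (i,j,m,l). -/
def T2quad {n : ℕ} (ρ : Matrix (Fin n → Fin 2) (Fin n → Fin 2) ℂ) (i j m l : Fin n) : ℝ :=
  ∑ k : Fin 2, ∑ k' : Fin 2, ∑ k'' : Fin 2, ∑ k''' : Fin 2,
    ((ρ * (onQubit (XY k) i * onQubit (XY k') j * onQubit (XY k'') m *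
        onQubit (XY k''') l)).trace.re) ^ 2

/-- The xz-plane Bell strength of the pair of qubits (i,j). -/
def T2pairXZ {n : ℕ} (ρ : Matrix (Fin n → Fin 2) (Fin n → Fin 2) ℂ) (i j : Fin n) : ℝ :=
  ∑ k : Fin 2, ∑ l : Fin 2,
    ((ρ * (onQubit (XZ k) i * onQubit (XZ l) j)).trace.re) ^ 2

/-- The tensor product of a family of single-qubit operators, as a monoid homomorphism. -/
def tensorHom (n : ℕ) :
    (Fin n → Matrix (Fin 2) (Fin 2) ℂ) →* Matrix (Fin n → Fin 2) (Fin n → Fin 2) ℂ where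
  toFun F := Matrix.of fun a b => ∏ s, F s (a s) (b s)
  map_one' := by
    ext a b
    simp only [Matrix.of_apply, Pi.one_apply, Matrix.one_apply, Finset.prod_ite_zero,
      Finset.prod_const_one, Finset.mem_univ, true_implies, funext_iff]
  map_mul' F G := by
    ext a b
    simp only [Matrix.of_apply, Pi.mul_apply, Matrix.mul_apply, ← Finset.prod_mul_distrib]
    exact Fintype.prod_sum _

lemma onQubit_eq_tensorHom {n : ℕ} (M : Matrix (Fin 2) (Fin 2) ℂ) (i : Fin n) :
    onQubit M i = tensorHom n (Pi.mulSingle i M) := by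
  ext a b
  change ∏ s : Fin n, _ = ∏ s, (Pi.mulSingle i M : Fin n → Matrix (Fin 2) (Fin 2) ℂ) s (a s) (b s)
  refine Finset.prod_congr rfl fun s _ => ?_
  rcases eq_or_ne s i with rfl | hs
  · simp
  · simp [hs, Matrix.one_apply]

lemma onQubit_mul {n : ℕ} (M N : Matrix (Fin 2) (Fin 2) ℂ) (i : Fin n) :
    onQubit M i * onQubit N i = onQubit (M * N) i := by
  simp only [onQubit_eq_tensorHom, ← map_mul, Pi.mulSingle_mul]

lemma onQubit_one {n : ℕ} (i : Fin n) : onQubit 1 i = 1 := by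
  rw [onQubit_eq_tensorHom, Pi.mulSingle_one, map_one]

lemma onQubit_commute {n : ℕ} (M N : Matrix (Fin 2) (Fin 2) ℂ) {i j : Fin n} (hij : i ≠ j) :
    Commute (onQubit M i) (onQubit N j) := by
  rw [onQubit_eq_tensorHom, onQubit_eq_tensorHom]
  exact (Pi.mulSingle_commute (f := fun _ => Matrix (Fin 2) (Fin 2) ℂ) hij M N).map (tensorHom n)

lemma onQubit_apply {n : ℕ} (M : Matrix (Fin 2) (Fin 2) ℂ) (i : Fin n) (a b : Fin n → Fin 2) :
    onQubit M i a b =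
      M (a i) (b i) * ∏ s ∈ Finset.univ.erase i, if a s = b s then 1 else 0 := by
  rw [onQubit, Matrix.of_apply, ← Finset.mul_prod_erase _ _ (Finset.mem_univ i), if_pos rfl]
  congr 1
  exact Finset.prod_congr rfl fun s hs => if_neg (Finset.ne_of_mem_erase hs)

lemma onQubit_add {n : ℕ} (M N : Matrix (Fin 2) (Fin 2) ℂ) (i : Fin n) :
    onQubit (M + N) i = onQubit M i + onQubit N i := by
  ext a b
  simp only [onQubit_apply, Matrix.add_apply, add_mul]

lemma onQubit_smul {n : ℕ} (c : ℂ) (M : Matrix (Fin 2) (Fin 2) ℂ) (i : Fin n) :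
    onQubit (c • M) i = c • onQubit M i := by
  ext a b
  simp only [onQubit_apply, Matrix.smul_apply, smul_eq_mul, mul_assoc]

lemma onQubit_isHermitian {n : ℕ} {M : Matrix (Fin 2) (Fin 2) ℂ} (hM : M.IsHermitian)
    (i : Fin n) : (onQubit M i).IsHermitian := by
  ext a b
  simp only [Matrix.conjTranspose_apply, onQubit_apply, star_mul', star_prod, hM.apply]
  congr 1
  refine Finset.prod_congr rfl fun s _ => ?_
  simp only [eq_comm (a := b s)]
  split_ifs <;> simp

lemma pX_isHermitian : pX.IsHermitian := by
  ext i j; fin_cases i <;> fin_cases j <;> simp [pX]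

lemma pY_isHermitian : pY.IsHermitian := by
  ext i j; fin_cases i <;> fin_cases j <;> simp [pY]

lemma pX_mul_pX : pX * pX = 1 := by
  ext i j; fin_cases i <;> fin_cases j <;> simp [pX]

lemma pY_mul_pY : pY * pY = 1 := by
  ext i j; fin_cases i <;> fin_cases j <;> simp [pY]

lemma pX_mul_pY : pX * pY = (-1 : ℂ) • (pY * pX) := by
  ext i j; fin_cases i <;> fin_cases j <;> simp [pX, pY]

/-- The single-qubit observable `a σ_x + b σ_y`. -/
def planar (a b : ℝ) : Matrix (Fin 2) (Fin 2) ℂ := (a : ℂ) • pX + (b : ℂ) • pY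

lemma planar_isHermitian (a b : ℝ) : (planar a b).IsHermitian := by
  simp [planar, Matrix.IsHermitian, Matrix.conjTranspose_add, Matrix.conjTranspose_smul,
    pX_isHermitian.eq, pY_isHermitian.eq]

lemma planar_mul_self (a b : ℝ) : planar a b * planar a b = ((a ^ 2 + b ^ 2 : ℝ) : ℂ) • 1 := by
  simp only [planar, add_mul, mul_add, smul_mul_smul_comm, pX_mul_pX, pY_mul_pY, pX_mul_pY]
  push_cast
  module

/-- The observable `σ_x (a σ_x + b σ_y) σ_y` on the qubits `p`, `q`, `r`. -/
def block {n : ℕ} (a b : ℝ) (p q r : Fin n) : Matrix (Fin n → Fin 2) (Fin n → Fin 2) ℂ :=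
  onQubit pX p * onQubit (planar a b) q * onQubit pY r

section block

variable {n : ℕ} {p q r : Fin n}

lemma block_isHermitian (a b : ℝ) (hpq : p ≠ q) (hpr : p ≠ r) (hqr : q ≠ r) :
    (block a b p q r).IsHermitian := by
  rw [Matrix.IsHermitian, block, Matrix.conjTranspose_mul, Matrix.conjTranspose_mul,
    (onQubit_isHermitian pX_isHermitian p).eq, (onQubit_isHermitian pY_isHermitian r).eq,
    (onQubit_isHermitian (planar_isHermitian a b) q).eq,
    ← (onQubit_commute pX (planar a b) hpq).eq]
  exact ((onQubit_commute _ _ hpr.symm).mul_right (onQubit_commute _ _ hqr.symm)).eq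

lemma block_mul_self (a b : ℝ) (hpq : p ≠ q) (hpr : p ≠ r) (hqr : q ≠ r) :
    block a b p q r * block a b p q r = ((a ^ 2 + b ^ 2 : ℝ) : ℂ) • 1 := by
  rw [block, ((onQubit_commute _ _ hpr.symm).mul_right
      (onQubit_commute _ _ hqr.symm)).mul_mul_mul_comm,
    (onQubit_commute _ _ hpq.symm).mul_mul_mul_comm, onQubit_mul, onQubit_mul, onQubit_mul,
    pX_mul_pX, pY_mul_pY, planar_mul_self, onQubit_smul]
  simp only [onQubit_one, one_mul, mul_one]

lemma block_anticommute (a b a' b' : ℝ) {q' r' : Fin n} (hpq' : p ≠ q') (hpr : p ≠ r)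
    (hpr' : p ≠ r') (hqq' : q ≠ q') (hqr : q ≠ r) (hqr' : q ≠ r') (hrq' : r ≠ q')
    (hrr' : r ≠ r') :
    block a b p q r * block a' b' r q' r' = -(block a' b' r q' r' * block a b p q r) := by
  have hP : Commute (onQubit pX p) (block a' b' r q' r') :=
    ((onQubit_commute _ _ hpr).mul_right (onQubit_commute _ _ hpq')).mul_right
      (onQubit_commute _ _ hpr')
  have hL : Commute (onQubit (planar a b) q) (block a' b' r q' r') :=
    ((onQubit_commute _ _ hqr).mul_right (onQubit_commute _ _ hqq')).mul_right
      (onQubit_commute _ _ hqr')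
  have hR : block a' b' r q' r' * onQubit pY r = -(onQubit pY r * block a' b' r q' r') := by
    have h1 : Commute (onQubit pY r) (onQubit (planar a' b') q' * onQubit pY r') :=
      (onQubit_commute _ _ hrq').mul_right (onQubit_commute _ _ hrr')
    have h2 : onQubit pX r * onQubit pY r = -(onQubit pY r * onQubit pX r) := by
      rw [onQubit_mul, onQubit_mul, pX_mul_pY, onQubit_smul, neg_one_smul]
    simp only [block]
    rw [mul_assoc (onQubit pX r), mul_assoc, ← h1.eq, ← mul_assoc, h2, neg_mul, mul_assoc]
  rw [show block a b p q r = onQubit pX p * onQubit (planar a b) q * onQubit pY r from rfl,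
    ← mul_assoc, ← (hP.mul_left hL).eq, mul_assoc _ (block a' b' r q' r'), hR, mul_neg, neg_neg,
    mul_assoc _ (onQubit pY r)]

lemma trace_mul_block_re (ρ : Matrix (Fin n → Fin 2) (Fin n → Fin 2) ℂ) (a b : ℝ) :
    (ρ * block a b p q r).trace.re =
      a * (ρ * (onQubit pX p * onQubit pX q * onQubit pY r)).trace.re +
      b * (ρ * (onQubit pX p * onQubit pY q * onQubit pY r)).trace.re := by
  simp only [block, planar, onQubit_add, onQubit_smul, mul_add, add_mul, mul_smul_comm,
    smul_mul_assoc, Matrix.trace_add, Matrix.trace_smul, smul_eq_mul, Complex.add_re,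
    Complex.re_ofReal_mul]

end block

section saturation

variable {ι : Type*} [Fintype ι] [DecidableEq ι] {ρ : Matrix ι ι ℂ}

open scoped MatrixOrder Matrix.Norms.L2Operator in
lemma exists_eq_conjTranspose_mul_self (hρ : ρ.PosSemidef) : ∃ B : Matrix ι ι ℂ, ρ = Bᴴ * B :=
  CStarAlgebra.nonneg_iff_eq_star_mul_self.1 hρ.nonneg

lemma mul_eq_zero_of_trace_mul_self_re {E : Matrix ι ι ℂ} (hρ : ρ.PosSemidef)
    (hE : E.IsHermitian) (h : (ρ * (E * E)).trace.re = 0) : ρ * E = 0 := by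
  have hps : (E * ρ * E).PosSemidef := by
    simpa only [hE.eq] using hρ.mul_mul_conjTranspose_same E
  have htr : (E * ρ * E).trace = 0 := by
    have hre : (E * ρ * E).trace.re = 0 := by
      rw [mul_assoc, Matrix.trace_mul_comm, mul_assoc, h]
    exact Complex.ext hre (Complex.nonneg_iff.1 hps.trace_nonneg).2.symm
  obtain ⟨B, rfl⟩ := exists_eq_conjTranspose_mul_self hρ
  have hBE : (B * E)ᴴ * (B * E) = 0 := by
    rw [Matrix.conjTranspose_mul, hE.eq, ← hps.trace_eq_zero_iff.1 htr]
    simp only [mul_assoc]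
  rw [mul_assoc, Matrix.conjTranspose_mul_self_eq_zero.1 hBE, mul_zero]

lemma mul_add_mul_eq_of_anticommute (hρ : ρ.PosSemidef) (htr : ρ.trace = 1) {A B : Matrix ι ι ℂ}
    (hA : A.IsHermitian) (hB : B.IsHermitian) (hA2 : A * A = (1 / 2 : ℂ) • 1)
    (hB2 : B * B = (1 / 2 : ℂ) • 1) (hAB : A * B = -(B * A))
    (hAt : (ρ * A).trace.re = 1 / 2) (hBt : (ρ * B).trace.re = 1 / 2) :
    ρ * A + ρ * B = ρ := by
  have hsq : (1 - A - B) * (1 - A - B) = (2 : ℂ) • (1 - A - B) := by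
    simp only [sub_mul, mul_sub, one_mul, mul_one, hA2, hB2, hAB]
    module
  have h0 := mul_eq_zero_of_trace_mul_self_re (E := 1 - A - B) hρ
    ((Matrix.isHermitian_one.sub hA).sub hB) (by
      rw [hsq]
      simp only [mul_smul_comm, mul_sub, mul_one, Matrix.trace_smul, Matrix.trace_sub, htr]
      simp [hAt, hBt]
      norm_num)
  rw [mul_sub, mul_sub, mul_one, sub_sub, sub_eq_zero] at h0
  exact h0.symm

/-- Observables of square `1 / 2` along an odd cycle, with neighbours anticommuting, cannot all
have expectation `1 / 2` in the same state. -/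
lemma not_all_expectation_eq_half {h : ℕ} (hodd : Odd h) (hρ : ρ.PosSemidef)
    (htr : ρ.trace = 1) (D : ℕ → Matrix ι ι ℂ) (hcyc : D h = D 0)
    (hD : ∀ k, (D k).IsHermitian) (hD2 : ∀ k, D k * D k = (1 / 2 : ℂ) • 1)
    (hanti : ∀ k, D k * D (k + 1) = -(D (k + 1) * D k)) :
    ¬ ∀ k, (ρ * D k).trace.re = 1 / 2 := by
  intro hexp
  have hstep : ∀ k, ρ * D k + ρ * D (k + 1) = ρ := fun k =>
    mul_add_mul_eq_of_anticommute hρ htr (hD k) (hD _) (hD2 k) (hD2 _) (hanti k) (hexp k) (hexp _)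
  have halt : ∀ k, ρ * D k - (1 / 2 : ℂ) • ρ = (-1 : ℂ) ^ k • (ρ * D 0 - (1 / 2 : ℂ) • ρ) := by
    intro k
    induction k with
    | zero => simp
    | succ k ih =>
      rw [pow_succ', mul_smul, ← ih, eq_sub_iff_add_eq'.2 (hstep k)]
      module
  have : IsAddTorsionFree (Matrix ι ι ℂ) := inferInstanceAs (IsAddTorsionFree (ι → ι → ℂ))
  have hhalf : ρ * D 0 = (1 / 2 : ℂ) • ρ := by
    have h1 := halt h
    rw [hcyc, hodd.neg_one_pow, neg_one_smul] at h1
    exact sub_eq_zero.1 (self_eq_neg.1 h1)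
  have h2 : (1 / 2 : ℂ) • ρ = (1 / 2 : ℂ) • (1 / 2 : ℂ) • ρ := by
    calc (1 / 2 : ℂ) • ρ = ρ * (D 0 * D 0) := by rw [hD2, mul_smul_comm, mul_one]
      _ = (1 / 2 : ℂ) • (1 / 2 : ℂ) • ρ := by rw [← mul_assoc, hhalf, smul_mul_assoc, hhalf]
  have h3 := congrArg Matrix.trace h2
  simp only [Matrix.trace_smul, htr, smul_eq_mul] at h3
  norm_num at h3

end saturation

/-- **Impossibility of balanced saturation on odd cycles.** For odd h ≥ 5, with 2h qubits
labeled 1,…,2h (here 0-indexed: label ℓ corresponds to index ℓ−1, and label 2h+1 is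
identified with 1), there is no 2h-qubit density matrix ρ with
𝒳_j(ρ) = ⟨X_{2j−1} X_{2j} Y_{2j+1}⟩² + ⟨X_{2j−1} Y_{2j} Y_{2j+1}⟩² = 1/2 for every
j = 1,…,h. -/
theorem no_balanced_saturation_odd_cycle (h : ℕ) (hh : 5 ≤ h) (hodd : Odd h) :
    ¬ ∃ ρ : Matrix (Fin (2 * h) → Fin 2) (Fin (2 * h) → Fin 2) ℂ,
      IsDensityMatrix ρ ∧
      ∀ j : Fin h,
        ((ρ * (onQubit pX ⟨2 * j.val, by have := j.isLt; omega⟩ *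
            onQubit pX ⟨2 * j.val + 1, by have := j.isLt; omega⟩ *
            onQubit pY ⟨(2 * j.val + 2) % (2 * h), Nat.mod_lt _ (by omega)⟩)).trace.re) ^ 2 +
        ((ρ * (onQubit pX ⟨2 * j.val, by have := j.isLt; omega⟩ *
            onQubit pY ⟨2 * j.val + 1, by have := j.isLt; omega⟩ *
            onQubit pY ⟨(2 * j.val + 2) % (2 * h), Nat.mod_lt _ (by omega)⟩)).trace.re) ^ 2
          = 1 / 2 := by
  rintro ⟨ρ, ⟨hρ, htr⟩, hX⟩
  have hmod : ∀ k : ℕ, k % h < h := fun k => Nat.mod_lt _ (by omega)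
  let p : ℕ → Fin (2 * h) := fun k => ⟨2 * k % (2 * h), Nat.mod_lt _ (by omega)⟩
  let q : ℕ → Fin (2 * h) := fun k => ⟨2 * (k % h) + 1, by have := hmod k; omega⟩
  have hpq : ∀ k l, p k ≠ q l := fun k l he => by
    have he' : 2 * k % (2 * h) = 2 * (l % h) + 1 := congrArg Fin.val he
    rw [Nat.mul_mod_mul_left] at he'
    omega
  have hne : ∀ k d, 0 < d → d < h → k % h ≠ (k + d) % h := fun k d hd hdh he => by
    have h1 : k + 0 ≡ k + d [MOD h] := he
    have h2 : 0 % h = d % h := Nat.ModEq.add_left_cancel' k h1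
    rw [Nat.zero_mod, Nat.mod_eq_of_lt hdh] at h2
    omega
  have hp : ∀ k d, 0 < d → d < h → p k ≠ p (k + d) := fun k d hd hdh he => by
    have he' : 2 * k % (2 * h) = 2 * (k + d) % (2 * h) := congrArg Fin.val he
    rw [Nat.mul_mod_mul_left, Nat.mul_mod_mul_left] at he'
    exact hne k d hd hdh (by omega)
  have hq : ∀ k, q k ≠ q (k + 1) := fun k he => by
    have he' : 2 * (k % h) + 1 = 2 * ((k + 1) % h) + 1 := congrArg Fin.val he
    exact hne k 1 (by omega) (by omega) (by omega)
  let a : ℕ → ℝ := fun k => (ρ * (onQubit pX (p k) * onQubit pX (q k) *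
    onQubit pY (p (k + 1)))).trace.re
  let b : ℕ → ℝ := fun k => (ρ * (onQubit pX (p k) * onQubit pY (q k) *
    onQubit pY (p (k + 1)))).trace.re
  have hab : ∀ k, a k ^ 2 + b k ^ 2 = 1 / 2 := fun k => by
    have hp0 : p k = ⟨2 * (k % h), by have := hmod k; omega⟩ :=
      Fin.ext (Nat.mul_mod_mul_left 2 k h)
    have hp1 : p (k + 1) = ⟨(2 * (k % h) + 2) % (2 * h), Nat.mod_lt _ (by omega)⟩ := by
      refine Fin.ext ?_
      change 2 * (k + 1) % (2 * h) = (2 * (k % h) + 2) % (2 * h)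
      rw [← Nat.mul_mod_mul_left, Nat.mod_add_mod, mul_add, mul_one]
    simp only [a, b, hp0, hp1]
    exact hX ⟨k % h, hmod k⟩
  refine not_all_expectation_eq_half hodd hρ htr
    (fun k => block (a k) (b k) (p k) (q k) (p (k + 1))) ?_ (fun k => ?_) (fun k => ?_)
    (fun k => ?_) (fun k => ?_)
  · have hp0 : p h = p 0 := by simp [p]
    have hp1 : p (h + 1) = p (0 + 1) := by simp [p, mul_add]
    have hq0 : q h = q 0 := by simp [q]
    simp only [a, b, hp0, hp1, hq0]
  · exact block_isHermitian _ _ (hpq _ _) (hp k 1 (by omega) (by omega)) (hpq _ _).symm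
  · rw [block_mul_self _ _ (hpq _ _) (hp k 1 (by omega) (by omega)) (hpq _ _).symm, hab]
    norm_num
  · exact block_anticommute _ _ _ _ (hpq _ _) (hp k 1 (by omega) (by omega))
      (hp k 2 (by omega) (by omega)) (hq k) (hpq _ _).symm (hpq _ _).symm (hpq _ _)
      (hp (k + 1) 1 (by omega) (by omega))
  · rw [trace_mul_block_re, ← hab k]
    simp only [a, b]
    ring
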